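/- Let 2 < p < ∞, set β_p = cos^{p−1}(π/(2p))/sin(π/(2p)), γ_p = cos^{p−1}(π/(2p)) / (sin(π/(2p))·sin^{p−1}(π/(2(p−1)))), and μ_p = (1 − √2/2)·(p−2)/p. Define V_p : ℝ × ℝ → ℝ by V_p(x,y) = β_p · Re(((|y| : ℂ) + i|x|)^p) (principal complex power) if |x| ≤ tan(π/(2(p−1)))·|y|, and V_p(x,y) = −γ_p·|x|^p otherwise. Then for all (x,y) ∈ ℝ², V_p(x,y) ≥ |y|^p − cot^p(π/(2p))·|x|^p + μ_p · | |y| − cot(π/(2p))·|x| |^p. -/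

import Mathlib

open Real

/-- The cosine lies above its chord on `[0, π / 4]`. -/
lemma one_sub_mul_le_cos_pi_div_four_mul {q : ℝ} (h0 : 0 ≤ q) (h1 : q ≤ 1) :
    1 - (1 - √2 / 2) * q ≤ cos (π / 4 * q) := by
  have h := strictConcaveOn_cos_Icc.concaveOn.2 (x := 0) (y := π / 4)
    ⟨by linarith [pi_pos], by linarith [pi_pos]⟩ ⟨by linarith [pi_pos], by linarith [pi_pos]⟩
    (sub_nonneg.2 h1) h0 (by ring)
  simp only [smul_eq_mul, mul_zero, zero_add, cos_zero, cos_pi_div_four] at h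
  rw [mul_comm (π / 4) q]
  linarith

lemma sqrt_two_bounds : 1.41 < √2 ∧ √2 < 1.42 :=
  ⟨lt_sqrt_of_sq_lt (by norm_num), (sqrt_lt' (by norm_num)).2 (by norm_num)⟩

/-- `sin (a (1 + x)) ≥ (1 + (√2 - 1) x) sin a` for `a ≤ π / 4` and `x ∈ [0, 1]`. -/
lemma one_add_mul_sin_le {a x : ℝ} (ha : 0 ≤ a) (ha' : a ≤ π / 4) (hx : 0 ≤ x) (hx' : x ≤ 1) :
    (1 + (√2 - 1) * x) * sin a ≤ sin (a * (1 + x)) := by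
  have h := strictConcaveOn_sin_Icc.concaveOn.2 (x := a) (y := 2 * a)
    ⟨ha, by linarith [pi_pos]⟩ ⟨by linarith, by linarith [pi_pos]⟩
    (sub_nonneg.2 hx') hx (by ring)
  simp only [smul_eq_mul] at h
  rw [sin_two_mul, show (1 - x) * a + x * (2 * a) = a * (1 + x) by ring] at h
  have hs : 0 ≤ sin a := sin_nonneg_of_nonneg_of_le_pi ha (by linarith [pi_pos])
  have hc : √2 / 2 ≤ cos a := by
    rw [← cos_pi_div_four]
    exact cos_le_cos_of_nonneg_of_le_pi ha (by linarith [pi_pos]) ha'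
  have := mul_le_mul_of_nonneg_right hc (mul_nonneg hx hs)
  linarith

lemma one_le_mul_cos_mul_rpow {p : ℝ} (hp : 2 < p) :
    1 ≤ (1 - (1 - √2 / 2) * (p - 2) / p) * cos (π / (2 * p)) *
      (sin (π / (2 * (p - 1))) / sin (π / (2 * p))) ^ (p - 1) := by
  have hp0 : p ≠ 0 := by positivity
  have hp1 : p - 1 ≠ 0 := by linarith
  have hq0 : 0 < 2 / p := by positivity
  have hq1 : 2 / p < 1 := by rw [div_lt_one (by linarith)]; exact hp
  have hcos := one_sub_mul_le_cos_pi_div_four_mul hq0.le hq1.le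
  rw [show π / 4 * (2 / p) = π / (2 * p) by field_simp; ring] at hcos
  rw [show (1 - √2 / 2) * (p - 2) / p = (1 - √2 / 2) * (1 - 2 / p) by field_simp]
  set q := 2 / p
  obtain ⟨hr1, hr2⟩ := sqrt_two_bounds
  have ha0 : 0 < π / (2 * p) := by positivity
  have ha1 : π / (2 * p) ≤ π / 4 := by
    gcongr
    linarith
  have hs : 0 < sin (π / (2 * p)) := sin_pos_of_pos_of_lt_pi ha0 (by linarith [pi_pos])
  have hx0 : 0 < 1 / (p - 1) := by
    have : 0 < p - 1 := by linarith
    positivity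
  have hx1 : 1 / (p - 1) ≤ 1 := by rw [div_le_one (by linarith)]; linarith
  have hsin := one_add_mul_sin_le ha0.le ha1 hx0.le hx1
  rw [show π / (2 * p) * (1 + 1 / (p - 1)) = π / (2 * (p - 1)) by field_simp; ring,
    ← le_div_iff₀ hs] at hsin
  have hpow : √2 ≤ (sin (π / (2 * (p - 1))) / sin (π / (2 * p))) ^ (p - 1) := by
    refine le_trans ?_ (rpow_le_rpow (by nlinarith) hsin (by linarith))
    refine le_trans (le_of_eq ?_) (one_add_mul_self_le_rpow_one_add (by nlinarith) (by linarith))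
    field_simp
    ring
  have hsq : √2 * √2 = 2 := mul_self_sqrt (by norm_num)
  have h1 : 0 < 1 - (1 - √2 / 2) * (1 - q) := by nlinarith
  have h2 : √2 / 2 ≤ (1 - (1 - √2 / 2) * (1 - q)) * cos (π / (2 * p)) := by
    refine le_trans ?_ (mul_le_mul_of_nonneg_left hcos h1.le)
    nlinarith [mul_nonneg (sq_nonneg (1 - √2 / 2)) (mul_nonneg hq0.le (sub_nonneg.2 hq1.le))]
  calc (1 : ℝ) = √2 / 2 * √2 := by linarith
    _ ≤ _ := mul_le_mul h2 hpow (by positivity) (by linarith)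

lemma tan_pi_div_four_sub_le {s : ℝ} (h0 : 0 ≤ s) (h1 : s < π / 4) :
    (1 + s) * sin (π / 4 - s) ≤ (1 - s) * cos (π / 4 - s) := by
  rw [sin_sub, cos_sub, sin_pi_div_four, cos_pi_div_four]
  have hc : 0 < cos s := cos_pos_of_mem_Ioo ⟨by linarith [pi_pos], by linarith [pi_pos]⟩
  have ht := le_tan h0 (by linarith [pi_pos])
  rw [tan_eq_sin_div_cos, le_div_iff₀ hc] at ht
  have : 0 ≤ √2 * (sin s - s * cos s) := mul_nonneg (sqrt_nonneg _) (by linarith)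
  linarith

lemma one_add_le_cos_rpow_div_sin {p : ℝ} (hp : 2 < p) :
    1 + (1 - √2 / 2) * (p - 2) / p ≤ cos (π / (2 * p)) ^ (p - 1) / sin (π / (2 * p)) := by
  have hp0 : p ≠ 0 := by positivity
  set r := 1 - 2 / p with hr
  have hq0 : 0 < 2 / p := by positivity
  have hq1 : 2 / p < 1 := by rw [div_lt_one (by linarith)]; exact hp
  have hr0 : 0 < r := by linarith
  have hr1 : r < 1 := by linarith
  rw [show (1 - √2 / 2) * (p - 2) / p = (1 - √2 / 2) * r by rw [hr]; field_simp]
  have ha0 : 0 < π / (2 * p) := by positivity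
  have ha1 : π / (2 * p) < π / 4 := by
    gcongr
    linarith
  set a := π / (2 * p) with ha
  have hs : 0 < sin a := sin_pos_of_pos_of_lt_pi ha0 (by linarith [pi_pos])
  have hc : 0 < cos a := cos_pos_of_mem_Ioo ⟨by linarith [pi_pos], by linarith [pi_pos]⟩
  have hcot : (1 + 3 / 4 * r) * sin a ≤ (1 - 3 / 4 * r) * cos a := by
    have h := tan_pi_div_four_sub_le (s := π / 4 * r) (by positivity) (by nlinarith [pi_pos])
    rw [show π / 4 - π / 4 * r = a by rw [ha, hr]; field_simp; ring] at h
    have : 0 ≤ (π - 3) * r * (sin a + cos a) := by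
      have := pi_gt_three
      exact mul_nonneg (mul_nonneg (by linarith) hr0.le) (by linarith)
    linarith
  have hcos : (1 / 2 : ℝ) ^ (2 / p) ≤ cos a ^ 2 := by
    have h1 := rpow_one_add_le_one_add_mul_self (s := -(1 / 2)) (by norm_num) hq0.le hq1.le
    norm_num only at h1
    have h2 := one_sub_mul_le_cos (x := 2 * a) (by linarith) (by linarith)
    rw [cos_two_mul, show 2 / π * (2 * a) = 2 / p by rw [ha]; field_simp] at h2
    norm_num only
    linarith
  have hpow : 1 / (1 + r) ≤ cos a ^ (p - 2) := by
    have h1 : (2 : ℝ) ^ r ≤ 1 + r := by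
      have := rpow_one_add_le_one_add_mul_self (s := 1) (by norm_num) hr0.le hr1.le
      norm_num only at this
      linarith
    calc 1 / (1 + r) ≤ 1 / 2 ^ r := by gcongr
      _ = ((1 / 2 : ℝ) ^ (2 / p)) ^ ((p - 2) / 2) := by
        rw [← rpow_mul (by norm_num), show 2 / p * ((p - 2) / 2) = r by rw [hr]; field_simp,
          div_rpow (by norm_num) (by norm_num), one_rpow]
      _ ≤ (cos a ^ 2) ^ ((p - 2) / 2) := by
        gcongr
      _ = cos a ^ (p - 2) := by
        rw [← rpow_natCast, ← rpow_mul hc.le]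
        congr 1
        push_cast
        ring
  obtain ⟨hr1', hr2'⟩ := sqrt_two_bounds
  rw [le_div_iff₀ hs, show p - 1 = (p - 2) + 1 by ring, rpow_add_one hc.ne']
  have hd : 0 < 1 - 3 / 4 * r := by linarith
  have h3 : (1 + (1 - √2 / 2) * r) * sin a ≤ 1 / (1 + r) * cos a := by
    rw [div_mul_eq_mul_div, one_mul, le_div_iff₀ (by linarith)]
    have h4 : (1 + (1 - √2 / 2) * r) * (1 + r) * (1 - 3 / 4 * r) ≤ 1 + 3 / 4 * r := by
      have : (1 + (1 - √2 / 2) * r) ≤ 1 + 0.3 * r := by nlinarith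
      calc _ ≤ (1 + 0.3 * r) * (1 + r) * (1 - 3 / 4 * r) := by gcongr
        _ ≤ _ := by nlinarith [mul_pos hr0 hr0, mul_pos hr0 (mul_pos hr0 hr0)]
    refine le_of_mul_le_mul_right ?_ hd
    calc _ = (1 + (1 - √2 / 2) * r) * (1 + r) * (1 - 3 / 4 * r) * sin a := by ring
      _ ≤ (1 + 3 / 4 * r) * sin a := by gcongr
      _ ≤ _ := by linarith
  calc _ ≤ _ := h3
    _ ≤ _ := by gcongr

lemma mul_div_le_cos_two_mul {p : ℝ} (hp : 2 < p) :
    (1 - √2 / 2) * (p - 2) / p ≤ cos (2 * (π / (2 * p))) := by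
  have hp0 : p ≠ 0 := by positivity
  have h2 := one_sub_mul_le_cos (x := 2 * (π / (2 * p))) (by positivity) (by
    rw [← mul_div_assoc, div_le_div_iff₀ (by positivity) (by positivity)]
    nlinarith [pi_pos])
  refine le_trans ?_ h2
  rw [show 2 / π * (2 * (π / (2 * p))) = 2 / p by field_simp,
    show (1 - √2 / 2) * (p - 2) / p = (1 - √2 / 2) * (1 - 2 / p) by field_simp]
  have hq1 : 2 / p < 1 := by rw [div_lt_one (by linarith)]; exact hp
  nlinarith [sqrt_two_bounds.1]

lemma re_cpow_polar {r φ : ℝ} (hr : 0 < r) (h : φ ∈ Set.Ioc (-π) π) (s : ℝ) :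
    ((((r * cos φ : ℝ) : ℂ) + Complex.I * ((r * sin φ : ℝ) : ℂ)) ^ (s : ℂ)).re =
      r ^ s * cos (φ * s) := by
  have e : ((r * cos φ : ℝ) : ℂ) + Complex.I * ((r * sin φ : ℝ) : ℂ) =
      r * (Complex.cos φ + Complex.sin φ * Complex.I) := by
    push_cast
    ring
  rw [e, Complex.cpow_ofReal_re, Complex.arg_mul_cos_add_sin_mul_I hr h, norm_mul,
    Complex.norm_cos_add_sin_mul_I, mul_one, Complex.norm_real, norm_of_nonneg hr.le]

lemma im_cpow_polar {r φ : ℝ} (hr : 0 < r) (h : φ ∈ Set.Ioc (-π) π) (s : ℝ) :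
    ((((r * cos φ : ℝ) : ℂ) + Complex.I * ((r * sin φ : ℝ) : ℂ)) ^ (s : ℂ)).im =
      r ^ s * sin (φ * s) := by
  have e : ((r * cos φ : ℝ) : ℂ) + Complex.I * ((r * sin φ : ℝ) : ℂ) =
      r * (Complex.cos φ + Complex.sin φ * Complex.I) := by
    push_cast
    ring
  rw [e, Complex.cpow_ofReal_im, Complex.arg_mul_cos_add_sin_mul_I hr h, norm_mul,
    Complex.norm_cos_add_sin_mul_I, mul_one, Complex.norm_real, norm_of_nonneg hr.le]

lemma re_one_add_I_mul_tan_cpow {φ : ℝ} (h : φ ∈ Set.Ioo (-(π / 2)) (π / 2)) (s : ℝ) :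
    ((1 + Complex.I * (tan φ : ℝ)) ^ (s : ℂ)).re = cos (φ * s) / cos φ ^ s := by
  have hc : 0 < cos φ := cos_pos_of_mem_Ioo h
  have := re_cpow_polar (r := (cos φ)⁻¹) (φ := φ) (by positivity)
    ⟨by linarith [h.1, pi_pos], by linarith [h.2, pi_pos]⟩ s
  rw [inv_mul_cancel₀ hc.ne', ← div_eq_inv_mul, ← tan_eq_sin_div_cos, inv_rpow hc.le,
    ← div_eq_inv_mul] at this
  exact_mod_cast this

lemma im_one_add_I_mul_tan_cpow {φ : ℝ} (h : φ ∈ Set.Ioo (-(π / 2)) (π / 2)) (s : ℝ) :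
    ((1 + Complex.I * (tan φ : ℝ)) ^ (s : ℂ)).im = sin (φ * s) / cos φ ^ s := by
  have hc : 0 < cos φ := cos_pos_of_mem_Ioo h
  have := im_cpow_polar (r := (cos φ)⁻¹) (φ := φ) (by positivity)
    ⟨by linarith [h.1, pi_pos], by linarith [h.2, pi_pos]⟩ s
  rw [inv_mul_cancel₀ hc.ne', ← div_eq_inv_mul, ← tan_eq_sin_div_cos, inv_rpow hc.le,
    ← div_eq_inv_mul] at this
  exact_mod_cast this

lemma re_cpow_eq_mul_re {X Y : ℝ} (hY : 0 < Y) (s : ℝ) :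
    (((Y : ℂ) + Complex.I * (X : ℂ)) ^ (s : ℂ)).re =
      Y ^ s * ((1 + Complex.I * ((X / Y : ℝ) : ℂ)) ^ (s : ℂ)).re := by
  have e : (Y : ℂ) + Complex.I * (X : ℂ) = (Y : ℂ) * (1 + Complex.I * ((X / Y : ℝ) : ℂ)) := by
    have : (Y : ℂ) ≠ 0 := by exact_mod_cast hY.ne'
    push_cast
    field_simp
  rw [e, Complex.cpow_ofReal_re, Complex.cpow_ofReal_re, Complex.arg_real_mul _ hY, norm_mul,
    Complex.norm_real, norm_of_nonneg hY.le, mul_rpow hY.le (norm_nonneg _), mul_assoc]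

lemma hasDerivAt_one_add_I_mul_cpow (s t : ℝ) :
    HasDerivAt (fun t : ℝ => (1 + Complex.I * (t : ℂ)) ^ (s : ℂ))
      (s * (1 + Complex.I * (t : ℂ)) ^ ((s - 1 : ℝ) : ℂ) * Complex.I) t := by
  have h1 : HasDerivAt (fun t : ℝ => 1 + Complex.I * (t : ℂ)) Complex.I t := by
    simpa using (Complex.ofRealCLM.hasDerivAt (x := t)).const_mul Complex.I |>.const_add 1
  have hz : 1 + Complex.I * (t : ℂ) ∈ Complex.slitPlane := by
    left
    simp
  have h2 := (hasDerivAt_id (1 + Complex.I * (t : ℂ))).cpow_const (c := (s : ℂ)) hz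
  refine (h2.comp t h1).congr_deriv ?_
  simp

lemma hasDerivAt_re_one_add_I_mul_cpow (s t : ℝ) :
    HasDerivAt (fun t : ℝ => ((1 + Complex.I * (t : ℂ)) ^ (s : ℂ)).re)
      (-(s * ((1 + Complex.I * (t : ℂ)) ^ ((s - 1 : ℝ) : ℂ)).im)) t := by
  have h := Complex.reCLM.hasFDerivAt.comp_hasDerivAt t (hasDerivAt_one_add_I_mul_cpow s t)
  refine h.congr_deriv ?_
  simp only [Complex.reCLM_apply, Complex.mul_I_re, Complex.im_ofReal_mul]

lemma hasDerivAt_im_one_add_I_mul_cpow (s t : ℝ) :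
    HasDerivAt (fun t : ℝ => ((1 + Complex.I * (t : ℂ)) ^ (s : ℂ)).im)
      (s * ((1 + Complex.I * (t : ℂ)) ^ ((s - 1 : ℝ) : ℂ)).re) t := by
  have h := Complex.imCLM.hasFDerivAt.comp_hasDerivAt t (hasDerivAt_one_add_I_mul_cpow s t)
  refine h.congr_deriv ?_
  simp only [Complex.imCLM_apply, Complex.mul_I_im, Complex.re_ofReal_mul]

lemma hasDerivAt_comparison (β μ c σ t : ℝ) {p : ℝ} (hp : 1 ≤ p) :
    HasDerivAt (fun t : ℝ => β * ((1 + Complex.I * (t : ℂ)) ^ (p : ℂ)).re - 1 + (c * t) ^ p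
        - μ * (σ * (1 - c * t)) ^ p)
      (p * (-β * ((1 + Complex.I * (t : ℂ)) ^ ((p - 1 : ℝ) : ℂ)).im + c * (c * t) ^ (p - 1)
        + μ * σ * c * (σ * (1 - c * t)) ^ (p - 1))) t := by
  have h1 := (hasDerivAt_re_one_add_I_mul_cpow p t).const_mul β
  have h2 := ((hasDerivAt_id t).const_mul c).rpow_const (p := p) (Or.inr hp)
  have h3 := ((((hasDerivAt_id t).const_mul c).const_sub 1).const_mul σ).rpow_const
    (p := p) (Or.inr hp)
  refine (((h1.sub_const 1).add h2).sub (h3.const_mul μ)).congr_deriv ?_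
  simp only [id]
  ring

lemma hasDerivAt_comparison_deriv (β μ c σ t : ℝ) {p : ℝ} (hp : 2 ≤ p) (hσ : σ * σ = 1) :
    HasDerivAt (fun t : ℝ => p * (-β * ((1 + Complex.I * (t : ℂ)) ^ ((p - 1 : ℝ) : ℂ)).im
        + c * (c * t) ^ (p - 1) + μ * σ * c * (σ * (1 - c * t)) ^ (p - 1)))
      (p * (p - 1) * (-β * ((1 + Complex.I * (t : ℂ)) ^ ((p - 2 : ℝ) : ℂ)).re
        + c ^ 2 * (c * t) ^ (p - 2) - μ * c ^ 2 * (σ * (1 - c * t)) ^ (p - 2))) t := by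
  have hp' : 1 ≤ p - 1 := by linarith
  have h1 := (hasDerivAt_im_one_add_I_mul_cpow (p - 1) t).const_mul (-β)
  have h2 := ((hasDerivAt_id t).const_mul c).rpow_const (p := p - 1) (Or.inr hp')
  have h3 := ((((hasDerivAt_id t).const_mul c).const_sub 1).const_mul σ).rpow_const
    (p := p - 1) (Or.inr hp')
  refine (((h1.add (h2.const_mul c)).add (h3.const_mul (μ * σ * c))).const_mul p).congr_deriv ?_
  simp only [id, show p - 1 - 1 = p - 2 by ring]
  linear_combination (-p * (p - 1) * μ * c ^ 2 * (σ * (1 - c * t)) ^ (p - 2)) * hσ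

lemma convexOn_Icc_of_hasDerivAt2_nonneg {f f' f'' : ℝ → ℝ} {u v : ℝ}
    (hf : ∀ x, HasDerivAt f (f' x) x) (hf' : ∀ x, HasDerivAt f' (f'' x) x)
    (h : ∀ x ∈ Set.Ioo u v, 0 ≤ f'' x) : ConvexOn ℝ (Set.Icc u v) f := by
  refine convexOn_of_hasDerivWithinAt2_nonneg (f' := f') (f'' := f'') (convex_Icc u v)
    (fun x _ => (hf x).continuousAt.continuousWithinAt)
    (fun x _ => (hf x).hasDerivWithinAt) (fun x _ => (hf' x).hasDerivWithinAt) ?_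
  rwa [interior_Icc]

lemma nonneg_of_convexOn_of_right {f : ℝ → ℝ} {u v t : ℝ} (h : ConvexOn ℝ (Set.Icc u v) f)
    (h0 : f v = 0) (h1 : HasDerivAt f 0 v) (ht : t ∈ Set.Icc u v) : 0 ≤ f t := by
  rcases ht.2.eq_or_lt with rfl | hlt
  · exact h0.ge
  have := h.slope_le_of_hasDerivAt ht ⟨ht.1.trans ht.2, le_rfl⟩ hlt h1
  rw [slope_def_field, h0, div_le_iff₀ (sub_pos.2 hlt)] at this
  linarith

lemma nonneg_of_convexOn_of_left {f : ℝ → ℝ} {u v t : ℝ} (h : ConvexOn ℝ (Set.Icc u v) f)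
    (h0 : f u = 0) (h1 : HasDerivAt f 0 u) (ht : t ∈ Set.Icc u v) : 0 ≤ f t := by
  rcases ht.1.eq_or_lt with rfl | hlt
  · exact h0.ge
  have := h.le_slope_of_hasDerivAt ⟨le_rfl, ht.1.trans ht.2⟩ ht hlt h1
  rw [slope_def_field, h0, le_div_iff₀ (sub_pos.2 hlt)] at this
  linarith

/-- If `f` is first concave, then convex on `[0, v]`, vanishes to second order at `v`, and is
nonnegative at `0`, then it is nonnegative on `[0, v]`. -/
lemma nonneg_of_hasDerivAt2_sign {f f' f'' : ℝ → ℝ} {τ v t : ℝ}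
    (hf : ∀ x, HasDerivAt f (f' x) x) (hf' : ∀ x, HasDerivAt f' (f'' x) x)
    (hneg : ∀ x ∈ Set.Ioo 0 τ, f'' x ≤ 0) (hpos : ∀ x ∈ Set.Ioo τ v, 0 ≤ f'' x)
    (hτ : τ ∈ Set.Icc 0 v) (h0 : 0 ≤ f 0) (hv : f v = 0) (hv' : f' v = 0)
    (ht : t ∈ Set.Icc 0 v) : 0 ≤ f t := by
  have hr : ∀ x ∈ Set.Icc τ v, 0 ≤ f x := fun x hx =>
    nonneg_of_convexOn_of_right (convexOn_Icc_of_hasDerivAt2_nonneg hf hf' hpos) hv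
      (hv' ▸ hf v) hx
  rcases le_total τ t with h | h
  · exact hr t ⟨h, ht.2⟩
  have hc : ConvexOn ℝ (Set.Icc 0 τ) (fun x => -f x) :=
    convexOn_Icc_of_hasDerivAt2_nonneg (fun x => (hf x).neg) (fun x => (hf' x).neg)
      (fun x hx => neg_nonneg.2 (hneg x hx))
  have := hc.le_max_of_mem_Icc ⟨le_rfl, hτ.1⟩ ⟨hτ.1, le_rfl⟩ ⟨ht.1, h⟩
  have h2 := hr τ ⟨le_rfl, hτ.2⟩
  have := this.trans (max_le (neg_nonpos.2 h0) (neg_nonpos.2 h2))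
  linarith

lemma comparison_nonneg {p β μ c T : ℝ} (hp : 2 < p) (hβ : 1 + μ ≤ β) (hμ : 0 ≤ μ) (hc : 0 < c)
    (h0 : ((1 + Complex.I * ((1 / c : ℝ) : ℂ)) ^ (p : ℂ)).re = 0)
    (h1 : β * ((1 + Complex.I * ((1 / c : ℝ) : ℂ)) ^ ((p - 1 : ℝ) : ℂ)).im = c)
    (h2 : β * ((1 + Complex.I * ((1 / c : ℝ) : ℂ)) ^ ((p - 2 : ℝ) : ℂ)).re ≤ c ^ 2 * (1 - μ))
    (hanti : ∀ s t : ℝ, 0 < s → s ≤ t → t ≤ T →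
      s ^ (p - 2) * ((1 + Complex.I * (t : ℂ)) ^ ((p - 2 : ℝ) : ℂ)).re ≤
        t ^ (p - 2) * ((1 + Complex.I * (s : ℂ)) ^ ((p - 2 : ℝ) : ℂ)).re)
    (hT : 1 / c ≤ T) {t : ℝ} (ht0 : 0 ≤ t) (htT : t ≤ T) :
    0 ≤ β * ((1 + Complex.I * (t : ℂ)) ^ (p : ℂ)).re - 1 + (c * t) ^ p
      - μ * |1 - c * t| ^ p := by
  have hc0 : 0 < 1 / c := by positivity
  have hcc : c * (1 / c) = 1 := by field_simp
  have he : 0 < p - 2 := by linarith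
  have hβ0 : 0 < β := by linarith
  have hp0 : p ≠ 0 := by positivity
  have hp1 : p - 1 ≠ 0 := by linarith
  have hpp : 0 < p * (p - 1) := mul_pos (by linarith) (by linarith)
  rcases le_total t (1 / c) with hle | hge
  · have habs : |1 - c * t| = 1 * (1 - c * t) := by
      rw [one_mul, abs_of_nonneg]
      rw [le_div_iff₀ hc] at hle
      linarith
    rw [habs]
    have hd2 := fun x => hasDerivAt_comparison_deriv β μ c 1 x hp.le (one_mul 1)
    set k : ℝ → ℝ := fun t => -β * ((1 + Complex.I * (t : ℂ)) ^ ((p - 2 : ℝ) : ℂ)).re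
        + c ^ 2 * (c * t) ^ (p - 2) - μ * c ^ 2 * (1 * (1 - c * t)) ^ (p - 2) with hk
    have hkcont : ContinuousOn k (Set.Icc 0 (1 / c)) := by
      intro x _
      refine ContinuousAt.continuousWithinAt ?_
      have e1 := (hasDerivAt_re_one_add_I_mul_cpow (p - 2) x).continuousAt
      have e2 : ContinuousAt (fun t : ℝ => (c * t) ^ (p - 2)) x :=
        (continuous_const.mul continuous_id).continuousAt.rpow_const (Or.inr he.le)
      have e3 : ContinuousAt (fun t : ℝ => (1 * (1 - c * t)) ^ (p - 2)) x :=
        (by fun_prop : Continuous fun t : ℝ => 1 * (1 - c * t)).continuousAt.rpow_const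
          (Or.inr he.le)
      exact ((e1.const_mul _).add (e2.const_mul _)).sub (e3.const_mul _)
    have hk0 : k 0 < 0 := by
      simp only [hk, Complex.ofReal_zero, mul_zero, add_zero, Complex.one_cpow, Complex.one_re,
        zero_rpow he.ne', sub_zero, mul_one, one_rpow]
      nlinarith [mul_nonneg hμ (sq_nonneg c)]
    have hk1 : 0 ≤ k (1 / c) := by
      simp only [hk, hcc, one_rpow, sub_self, mul_zero, zero_rpow he.ne']
      nlinarith [mul_nonneg hμ (sq_nonneg c)]
    have hmono : ∀ s t : ℝ, 0 < s → s ≤ t → t ≤ 1 / c →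
        t ^ (p - 2) * k s ≤ s ^ (p - 2) * k t := by
      intro s t hs hst htc
      have ht : 0 < t := hs.trans_le hst
      have hct : 0 ≤ 1 - c * t := by
        rw [le_div_iff₀ hc] at htc
        linarith
      have hcs : 0 ≤ 1 - c * s := hct.trans (by gcongr)
      have a1 := mul_le_mul_of_nonneg_left (hanti s t hs hst (htc.trans hT)) hβ0.le
      have a2 : t ^ (p - 2) * (c * s) ^ (p - 2) = s ^ (p - 2) * (c * t) ^ (p - 2) := by
        rw [← mul_rpow ht.le (by positivity), ← mul_rpow hs.le (by positivity)]
        congr 1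
        ring
      have a3 : s ^ (p - 2) * (1 - c * t) ^ (p - 2) ≤ t ^ (p - 2) * (1 - c * s) ^ (p - 2) := by
        gcongr
      have a4 := mul_le_mul_of_nonneg_left a3 (mul_nonneg hμ (sq_nonneg c))
      simp only [hk, one_mul]
      linear_combination a1 + a4 + c ^ 2 * a2
    obtain ⟨τ, hτ, hkτ⟩ := intermediate_value_Icc hc0.le hkcont ⟨hk0.le, hk1⟩
    have hτ0 : 0 < τ := by
      rcases hτ.1.eq_or_lt with h | h
      · rw [← h] at hkτ
        exact absurd hkτ hk0.ne
      · exact h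
    refine nonneg_of_hasDerivAt2_sign (τ := τ) (v := 1 / c)
      (f := fun t : ℝ => β * ((1 + Complex.I * (t : ℂ)) ^ (p : ℂ)).re - 1 + (c * t) ^ p
        - μ * (1 * (1 - c * t)) ^ p)
      (fun x => hasDerivAt_comparison β μ c 1 x (by linarith : 1 ≤ p)) hd2 ?_ ?_ hτ ?_ ?_ ?_
      ⟨ht0, hle⟩
    · intro x hx
      have h := hmono x τ hx.1 hx.2.le hτ.2
      rw [hkτ, mul_zero] at h
      exact mul_nonpos_of_nonneg_of_nonpos hpp.le
        (nonpos_of_mul_nonpos_right h (rpow_pos_of_pos hτ0 _))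
    · intro x hx
      have h := hmono τ x hτ0 hx.1.le hx.2.le
      rw [hkτ, mul_zero] at h
      exact mul_nonneg hpp.le (nonneg_of_mul_nonneg_right h (rpow_pos_of_pos hτ0 _))
    · simp only [Complex.ofReal_zero, mul_zero, add_zero, Complex.one_cpow, Complex.one_re,
        zero_rpow hp0, sub_zero, mul_one, one_rpow]
      linarith
    · simp only [h0, hcc, one_rpow, sub_self, mul_zero, zero_rpow hp0]
      norm_num
    · simp only [hcc, one_rpow, sub_self, mul_zero, zero_rpow hp1]
      linear_combination (-p) * h1
  · have habs : |1 - c * t| = -1 * (1 - c * t) := by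
      rw [neg_one_mul, abs_of_nonpos]
      rw [div_le_iff₀ hc] at hge
      linarith
    rw [habs]
    have hd := fun x => hasDerivAt_comparison β μ c (-1) x (by linarith : 1 ≤ p)
    refine nonneg_of_convexOn_of_left (u := 1 / c) (v := T)
      (f := fun t : ℝ => β * ((1 + Complex.I * (t : ℂ)) ^ (p : ℂ)).re - 1 + (c * t) ^ p
        - μ * (-1 * (1 - c * t)) ^ p)
      (convexOn_Icc_of_hasDerivAt2_nonneg hd
        (fun x => hasDerivAt_comparison_deriv β μ c (-1) x hp.le (by norm_num)) ?_) ?_ ?_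
      ⟨hge, htT⟩
    · intro x hx
      refine mul_nonneg hpp.le ?_
      have hx0 : 0 < x := hc0.trans hx.1
      have hx1 : 0 ≤ -1 * (1 - c * x) := by
        have := hx.1.le
        rw [div_le_iff₀ hc] at this
        linarith
      have a1 := mul_le_mul_of_nonneg_left (hanti (1 / c) x hc0 hx.1.le hx.2.le) hβ0.le
      have a2 := mul_le_mul_of_nonneg_left h2 (rpow_pos_of_pos hx0 (p - 2)).le
      have a3 : (-1 * (1 - c * x)) ^ (p - 2) ≤ (c * x) ^ (p - 2) :=
        rpow_le_rpow hx1 (by linarith) he.le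
      have a4 := mul_le_mul_of_nonneg_left a3 (mul_nonneg hμ (sq_nonneg c))
      have a5 : c ^ (p - 2) * (1 / c) ^ (p - 2) = 1 := by
        rw [← mul_rpow hc.le hc0.le, hcc, one_rpow]
      have a6 := mul_le_mul_of_nonneg_left (a1.trans (by linarith [a2] :
        _ ≤ x ^ (p - 2) * (c ^ 2 * (1 - μ)))) (rpow_pos_of_pos hc (p - 2)).le
      rw [mul_rpow hc.le hx0.le] at a4 ⊢
      have a7 : β * ((1 + Complex.I * (x : ℂ)) ^ ((p - 2 : ℝ) : ℂ)).re ≤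
          c ^ (p - 2) * (x ^ (p - 2) * (c ^ 2 * (1 - μ))) := by
        linear_combination a6 - β * ((1 + Complex.I * (x : ℂ)) ^ ((p - 2 : ℝ) : ℂ)).re * a5
      linarith
    · simp only [h0, hcc, one_rpow, sub_self, mul_zero, zero_rpow hp0]
      norm_num
    · refine (hd (1 / c)).congr_deriv ?_
      simp only [hcc, one_rpow, sub_self, mul_zero, zero_rpow hp1]
      linear_combination (-p) * h1

lemma rpow_mul_re_cpow_anti {e b s t : ℝ} (he : 0 ≤ e) (hb0 : 0 ≤ b) (hb : b < π / 2)
    (heb : b * e ≤ π / 2) (hs : 0 < s) (hst : s ≤ t) (ht : t ≤ tan b) :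
    s ^ e * ((1 + Complex.I * (t : ℂ)) ^ (e : ℂ)).re ≤
      t ^ e * ((1 + Complex.I * (s : ℂ)) ^ (e : ℂ)).re := by
  have hmem : ∀ x, arctan x ∈ Set.Ioo (-(π / 2)) (π / 2) := arctan_mem_Ioo
  have hs' : 0 < arctan s := arctan_pos.2 hs
  have hst' : arctan s ≤ arctan t := arctan_strictMono.monotone hst
  have htb : arctan t ≤ b := by
    rw [← arctan_tan (by linarith [pi_pos]) hb]
    exact arctan_strictMono.monotone ht
  rw [← tan_arctan s, ← tan_arctan t, re_one_add_I_mul_tan_cpow (hmem s),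
    re_one_add_I_mul_tan_cpow (hmem t)]
  generalize arctan s = φ at *
  generalize arctan t = θ at *
  have hθ : θ < π / 2 := htb.trans_lt hb
  have hcφ : 0 < cos φ := cos_pos_of_mem_Ioo ⟨by linarith [pi_pos], by linarith⟩
  have hcθ : 0 < cos θ := cos_pos_of_mem_Ioo ⟨by linarith [pi_pos], by linarith⟩
  have hsφ : 0 < sin φ := sin_pos_of_pos_of_lt_pi hs' (by linarith [pi_pos])
  have hsθ : sin φ ≤ sin θ := sin_le_sin_of_le_of_le_pi_div_two (by linarith) hθ.le hst'
  have hθe : θ * e ≤ π / 2 := (mul_le_mul_of_nonneg_right htb he).trans heb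
  have hθe0 : 0 ≤ θ * e := mul_nonneg (by linarith) he
  have hcos0 : 0 ≤ cos (θ * e) := cos_nonneg_of_neg_pi_div_two_le_of_le (by linarith [pi_pos]) hθe
  have hcos : cos (θ * e) ≤ cos (φ * e) :=
    cos_le_cos_of_nonneg_of_le_pi (mul_nonneg hs'.le he) (by linarith [pi_pos])
      (mul_le_mul_of_nonneg_right hst' he)
  rw [tan_eq_sin_div_cos, tan_eq_sin_div_cos, div_rpow hsφ.le hcφ.le,
    div_rpow (hsφ.le.trans hsθ) hcθ.le, div_mul_div_comm, div_mul_div_comm,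
    mul_comm (cos θ ^ e)]
  have := hsφ.le.trans hsθ
  gcongr

lemma comparison_nonneg_of_le_tan {p β μ t : ℝ} (hp : 2 < p)
    (hβ : β = cos (π / (2 * p)) ^ (p - 1) / sin (π / (2 * p)))
    (hμ : μ = (1 - √2 / 2) * (p - 2) / p) (ht0 : 0 ≤ t) (ht : t ≤ tan (π / (2 * (p - 1)))) :
    0 ≤ β * ((1 + Complex.I * (t : ℂ)) ^ (p : ℂ)).re - 1 + (cot (π / (2 * p)) * t) ^ p
      - μ * |1 - cot (π / (2 * p)) * t| ^ p := by
  have hp0 : p ≠ 0 := by positivity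
  have hp1 : 0 < p - 1 := by linarith
  have h1 := one_add_le_cos_rpow_div_sin hp
  have h2 := mul_div_le_cos_two_mul hp
  rw [← hμ] at h1 h2
  rw [← hβ] at h1
  have hμ0 : 0 ≤ μ := by
    rw [hμ]
    exact div_nonneg (mul_nonneg (by linarith [sqrt_two_bounds.2]) (by linarith)) (by linarith)
  have hb0 : 0 < π / (2 * (p - 1)) := by positivity
  have hb1 : π / (2 * (p - 1)) < π / 2 := by
    gcongr
    linarith
  have hbe : π / (2 * (p - 1)) * (p - 2) ≤ π / 2 := by
    rw [div_mul_eq_mul_div, div_le_div_iff₀ (by positivity) (by positivity)]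
    nlinarith [pi_pos]
  have ha0 : 0 < π / (2 * p) := by positivity
  have hab : π / (2 * p) < π / (2 * (p - 1)) := by
    gcongr
    linarith
  have hap : π / (2 * p) * p = π / 2 := by field_simp
  set a := π / (2 * p)
  have hmem : a ∈ Set.Ioo (-(π / 2)) (π / 2) := ⟨by linarith, by linarith⟩
  have hs : 0 < sin a := sin_pos_of_pos_of_lt_pi ha0 (by linarith [pi_pos])
  have hc : 0 < cos a := cos_pos_of_mem_Ioo hmem
  have hcot : cot a = cos a / sin a := cot_eq_cos_div_sin a
  have htan : 1 / cot a = tan a := by rw [hcot, tan_eq_sin_div_cos, one_div_div]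
  have hpow : cos a ^ (p - 1) = cos a ^ (p - 2) * cos a := by
    rw [← rpow_add_one hc.ne']
    congr 1
    ring
  refine comparison_nonneg hp h1 hμ0 (hcot ▸ div_pos hc hs) ?_ ?_ ?_ ?_ ?_ ht0 ht
  · rw [htan, re_one_add_I_mul_tan_cpow hmem, hap, cos_pi_div_two, zero_div]
  · rw [htan, im_one_add_I_mul_tan_cpow hmem, mul_sub_one, hap, sin_pi_div_two_sub, hβ, hcot]
    field_simp
  · rw [htan, re_one_add_I_mul_tan_cpow hmem, mul_sub, hap, cos_pi_div_two_sub,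
      mul_comm a 2, hβ, hcot, hpow, sin_two_mul]
    have hcc : 0 < cos a ^ (p - 2) := rpow_pos_of_pos hc _
    rw [cos_two_mul, cos_sq'] at h2
    calc _ = (cos a / sin a) ^ 2 * (2 * sin a ^ 2) := by field_simp
      _ ≤ _ := by
        gcongr
        linarith
  · intro s t hs hst ht
    exact rpow_mul_re_cpow_anti (by linarith) hb0.le hb1 hbe hs hst ht
  · rw [htan]
    exact (tan_lt_tan_of_lt_of_lt_pi_div_two (by linarith) hb1 hab).le

lemma rpow_add_mul_le_of_le_cot {p γ μ u : ℝ} (hp : 2 < p)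
    (hγ : γ = cos (π / (2 * p)) ^ (p - 1) /
        (sin (π / (2 * p)) * sin (π / (2 * (p - 1))) ^ (p - 1)))
    (hμ : μ = (1 - √2 / 2) * (p - 2) / p) (hu0 : 0 ≤ u) (hu : u ≤ cot (π / (2 * (p - 1)))) :
    u ^ p + μ * |u - cot (π / (2 * p))| ^ p ≤ cot (π / (2 * p)) ^ p - γ := by
  have hp0 : p ≠ 0 := by positivity
  have hp1 : 0 < p - 1 := by linarith
  have hμ0 : 0 ≤ μ := by
    rw [hμ]
    exact div_nonneg (mul_nonneg (by linarith [sqrt_two_bounds.2]) (by linarith)) (by linarith)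
  have hB := one_le_mul_cos_mul_rpow hp
  rw [← hμ] at hB
  have hb0 : 0 < π / (2 * (p - 1)) := by positivity
  have hb1 : π / (2 * (p - 1)) < π / 2 := by
    gcongr
    linarith
  have ha0 : 0 < π / (2 * p) := by positivity
  have hab : π / (2 * p) < π / (2 * (p - 1)) := by
    gcongr
    linarith
  have hsb : 0 < sin (π / (2 * (p - 1))) := sin_pos_of_pos_of_lt_pi hb0 (by linarith [pi_pos])
  have hcb : 0 < cos (π / (2 * (p - 1))) := cos_pos_of_mem_Ioo ⟨by linarith, by linarith⟩
  have hcotb := cot_eq_cos_div_sin (π / (2 * (p - 1)))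
  have htanb := tan_eq_sin_div_cos (π / (2 * (p - 1)))
  have hT := comparison_nonneg_of_le_tan hp rfl hμ (htanb ▸ (div_pos hsb hcb).le) le_rfl
  rw [re_one_add_I_mul_tan_cpow ⟨by linarith, by linarith⟩,
    show π / (2 * (p - 1)) * p = π / (2 * (p - 1)) + π / 2 by field_simp; ring,
    cos_add_pi_div_two] at hT
  set b := π / (2 * (p - 1))
  set a := π / (2 * p)
  have hsa : 0 < sin a := sin_pos_of_pos_of_lt_pi ha0 (by linarith [pi_pos])
  have hca : 0 < cos a := cos_pos_of_mem_Ioo ⟨by linarith, by linarith⟩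
  have hcota : cot a = cos a / sin a := cot_eq_cos_div_sin a
  have hcota0 : 0 < cot a := hcota ▸ div_pos hca hsa
  have hcotb0 : 0 < cot b := hcotb ▸ div_pos hcb hsb
  have hconv : ConvexOn ℝ (Set.Icc 0 (cot b)) (fun u => u ^ p + μ * |u - cot a| ^ p) := by
    have hrpow : ConvexOn ℝ (Set.Ici (0 : ℝ)) (fun u => u ^ p) := convexOn_rpow (by linarith)
    have h1 : ConvexOn ℝ (Set.Icc 0 (cot b)) (fun u : ℝ => u ^ p) :=
      hrpow.subset (fun u hu => hu.1) (convex_Icc _ _)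
    have h2 : ConvexOn ℝ (Set.Icc 0 (cot b)) (fun u : ℝ => |u - cot a| ^ p) := by
      refine ⟨convex_Icc _ _, fun x _ y _ v w hv hw hvw => ?_⟩
      refine le_trans ?_ (hrpow.2 (abs_nonneg (x - cot a)) (abs_nonneg (y - cot a)) hv hw hvw)
      refine rpow_le_rpow (abs_nonneg _) ?_ (by linarith)
      simp only [smul_eq_mul]
      rw [show v * x + w * y - cot a = v * (x - cot a) + w * (y - cot a) by
        linear_combination cot a * hvw]
      refine (abs_add_le _ _).trans ?_
      rw [abs_mul, abs_mul, abs_of_nonneg hv, abs_of_nonneg hw]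
    exact h1.add (h2.smul hμ0)
  refine (hconv.le_max_of_mem_Icc ⟨le_rfl, hcotb0.le⟩ ⟨hcotb0.le, le_rfl⟩ ⟨hu0, hu⟩).trans
    (max_le ?_ ?_)
  · have hsap : 0 < sin a ^ (p - 1) := rpow_pos_of_pos hsa _
    have hsbp : 0 < sin b ^ (p - 1) := rpow_pos_of_pos hsb _
    have hcap : 0 < cos a ^ (p - 1) := rpow_pos_of_pos hca _
    have hcotp : cot a ^ p = cos a ^ (p - 1) * cos a / (sin a ^ (p - 1) * sin a) := by
      rw [hcota, div_rpow hca.le hsa.le, ← rpow_add_one hca.ne', ← rpow_add_one hsa.ne',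
        sub_add_cancel]
    rw [zero_rpow hp0, zero_sub, abs_neg, abs_of_pos hcota0, zero_add]
    have : γ ≤ (1 - μ) * cot a ^ p := by
      calc γ = cos a ^ (p - 1) / (sin a * sin b ^ (p - 1)) * 1 := by rw [hγ, mul_one]
        _ ≤ cos a ^ (p - 1) / (sin a * sin b ^ (p - 1)) *
            ((1 - μ) * cos a * (sin b / sin a) ^ (p - 1)) := by gcongr
        _ = (1 - μ) * cot a ^ p := by
          rw [hcotp, div_rpow hsb.le hsa.le]
          field_simp
    linarith
  · have hm := mul_nonneg (rpow_pos_of_pos hcotb0 p).le hT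
    have e1 : cot b * tan b = 1 := by
      rw [hcotb, htanb]
      field_simp
    have htb0 : 0 < tan b := htanb ▸ div_pos hsb hcb
    have e2 : cot b ^ p * (cot a * tan b) ^ p = cot a ^ p := by
      rw [← mul_rpow hcotb0.le (by positivity)]
      congr 1
      linear_combination cot a * e1
    have e3 : cot b ^ p * |1 - cot a * tan b| ^ p = |cot b - cot a| ^ p := by
      rw [← mul_rpow hcotb0.le (abs_nonneg _), ← abs_of_pos hcotb0, ← abs_mul,
        abs_of_pos hcotb0]
      congr 2
      linear_combination (-cot a) * e1
    have e4 : cot b ^ p * (cos a ^ (p - 1) / sin a * (-sin b / cos b ^ p)) = -γ := by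
      have hbp : sin b ^ p = sin b ^ (p - 1) * sin b := by
        rw [← rpow_add_one hsb.ne', sub_add_cancel]
      have : 0 < sin b ^ (p - 1) := rpow_pos_of_pos hsb _
      have : 0 < cos b ^ p := rpow_pos_of_pos hcb _
      rw [hcotb, div_rpow hcb.le hsb.le, hbp, hγ]
      field_simp
    linear_combination hm + e2 - μ * e3 + e4

theorem stmt_19 (p : ℝ) (hp : 2 < p)
    (β γ μ : ℝ)
    (hβ : β = Real.cos (π / (2 * p)) ^ (p - 1) / Real.sin (π / (2 * p)))
    (hγ : γ = Real.cos (π / (2 * p)) ^ (p - 1) /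
        (Real.sin (π / (2 * p)) * Real.sin (π / (2 * (p - 1))) ^ (p - 1)))
    (hμ : μ = (1 - Real.sqrt 2 / 2) * (p - 2) / p)
    (x y : ℝ) :
    (if |x| ≤ Real.tan (π / (2 * (p - 1))) * |y| then
        β * ((((|y| : ℝ) : ℂ) + Complex.I * ((|x| : ℝ) : ℂ)) ^ (p : ℂ)).re
      else -γ * |x| ^ p) ≥
      |y| ^ p - Real.cot (π / (2 * p)) ^ p * |x| ^ p +
        μ * |(|y| - Real.cot (π / (2 * p)) * |x|)| ^ p := by
  have hp0 : p ≠ 0 := by positivity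
  have hp1 : 0 < p - 1 := by linarith
  have hb0 : 0 < π / (2 * (p - 1)) := by positivity
  have hb1 : π / (2 * (p - 1)) < π / 2 := by
    gcongr
    linarith
  have hsb : 0 < sin (π / (2 * (p - 1))) := sin_pos_of_pos_of_lt_pi hb0 (by linarith [pi_pos])
  have hcb : 0 < cos (π / (2 * (p - 1))) := cos_pos_of_mem_Ioo ⟨by linarith, by linarith⟩
  have ha0 : 0 < π / (2 * p) := by positivity
  have ha1 : π / (2 * p) < π / 2 := by
    gcongr
    linarith
  have hcot0 : 0 < cot (π / (2 * p)) := by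
    rw [cot_eq_cos_div_sin]
    exact div_pos (cos_pos_of_mem_Ioo ⟨by linarith, by linarith⟩)
      (sin_pos_of_pos_of_lt_pi ha0 (by linarith))
  have hX := abs_nonneg x
  have hY := abs_nonneg y
  generalize |x| = X at *
  generalize |y| = Y at *
  rw [ge_iff_le]
  split_ifs with h
  · rcases hY.eq_or_lt with rfl | hY
    · have hX0 : X = 0 := by linarith
      have hpc : (p : ℂ) ≠ 0 := by exact_mod_cast hp0
      simp [hX0, zero_rpow hp0, Complex.zero_cpow hpc]
    have hmain := comparison_nonneg_of_le_tan hp hβ hμ (div_nonneg hX hY.le)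
      ((div_le_iff₀ hY).2 h)
    have hm := mul_nonneg (rpow_pos_of_pos hY p).le hmain
    have e2 : Y ^ p * (cot (π / (2 * p)) * (X / Y)) ^ p = cot (π / (2 * p)) ^ p * X ^ p := by
      rw [← mul_rpow hY.le (by positivity), ← mul_rpow hcot0.le hX]
      congr 1
      field_simp
    have e3 : Y ^ p * |1 - cot (π / (2 * p)) * (X / Y)| ^ p
        = |Y - cot (π / (2 * p)) * X| ^ p := by
      rw [← mul_rpow hY.le (abs_nonneg _), ← abs_of_pos hY, ← abs_mul, abs_of_pos hY]
      congr 2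
      field_simp
    rw [re_cpow_eq_mul_re hY]
    linear_combination hm + e2 - μ * e3
  · push Not at h
    have hX : 0 < X := by
      refine lt_of_le_of_lt (mul_nonneg ?_ hY) h
      rw [tan_eq_sin_div_cos]
      exact (div_pos hsb hcb).le
    have hu : Y / X ≤ cot (π / (2 * (p - 1))) := by
      rw [tan_eq_sin_div_cos, div_mul_eq_mul_div, div_lt_iff₀ hcb] at h
      rw [cot_eq_cos_div_sin, div_le_div_iff₀ hX hsb]
      linarith
    have hm := mul_le_mul_of_nonneg_left
      (rpow_add_mul_le_of_le_cot hp hγ hμ (div_nonneg hY hX.le) hu) (rpow_pos_of_pos hX p).le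
    have e1 : X ^ p * (Y / X) ^ p = Y ^ p := by
      rw [← mul_rpow hX.le (by positivity), mul_div_cancel₀ _ hX.ne']
    have e3 : X ^ p * |Y / X - cot (π / (2 * p))| ^ p
        = |Y - cot (π / (2 * p)) * X| ^ p := by
      rw [← mul_rpow hX.le (abs_nonneg _), ← abs_of_pos hX, ← abs_mul, abs_of_pos hX]
      congr 2
      field_simp
    linear_combination hm - e1 - μ * e3
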